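/- arXiv:1105.4158 — 3 statements merged into one kernel-verified Lean document; each statement's English description precedes it below -/
import Mathlib

section
/- Let n ≥ 1 and ν₁, ν₂ : Fin n × Fin n → ℂ. Then Σ_{(π₁,π₂)} ∏_i ν₁(i, π₁(i))·ν₂(i, π₂(i)) = Σ_{(π₁,π₂)} 2^{−k(π₁,π₂)} · (∏_{i fixed by τ} ν₁(i, π₁(i))·ν₂(i, π₁(i))) · ∏_C ( w₁(C) + w₂(C) ), where both sums are over all ordered pairs (π₁,π₂) of permutations of Fin n, τ = π₂⁻¹ ∘ π₁, k(π₁,π₂) is the number of cycles of τ of length ≥ 2, the product over C runs over those cycles, and for such a cycle C with support S ⊆ Fin n one sets w₁(C) = (∏_{i ∈ S} ν₁(i, π₁(i))) · (∏_{i ∈ S} ν₂(i, π₂(i))) and w₂(C) = (∏_{i ∈ S} ν₂(i, π₁(i))) · (∏_{i ∈ S} ν₁(i, π₂(i))). -/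
open scoped BigOperators

namespace Equiv.Perm

theorem inv_mul_mul_inv_eq {α : Type*} {σ τ : Perm α} (h : Disjoint σ (σ⁻¹ * τ)) :
    σ⁻¹ * τ * σ⁻¹ = σ⁻¹ * (σ⁻¹ * τ) :=
  (h.inv_left.commute.eq).symm

variable {α : Type*} [Fintype α] [DecidableEq α]

theorem cycleFactorsFinset_inv_mul {σ τ : Perm α} (h : Disjoint σ (σ⁻¹ * τ)) :
    (σ⁻¹ * τ).cycleFactorsFinset = τ.cycleFactorsFinset \ σ.cycleFactorsFinset := by
  have hu := h.cycleFactorsFinset_mul_eq_union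
  rw [mul_inv_cancel_left] at hu
  rw [hu, Finset.union_sdiff_cancel_left h.disjoint_cycleFactorsFinset]

theorem cycleFactorsFinset_subset_of_disjoint {σ τ : Perm α} (h : Disjoint σ (σ⁻¹ * τ)) :
    σ.cycleFactorsFinset ⊆ τ.cycleFactorsFinset := by
  have hu := h.cycleFactorsFinset_mul_eq_union
  rw [mul_inv_cancel_left] at hu
  exact hu ▸ Finset.subset_union_left

theorem exists_cycleFactorsFinset_eq {τ : Perm α} {U : Finset (Perm α)}
    (hU : U ⊆ τ.cycleFactorsFinset) : ∃ σ : Perm α, σ.cycleFactorsFinset = U := by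
  have hd : (U : Set (Perm α)).Pairwise Disjoint :=
    τ.cycleFactorsFinset_pairwise_disjoint.mono (Finset.coe_subset.2 hU)
  exact ⟨U.noncommProd id (hd.mono' fun _ _ => Disjoint.commute),
    cycleFactorsFinset_eq_finset.2
      ⟨fun f hf => (mem_cycleFactorsFinset_iff.1 (hU hf)).1, hd, rfl⟩⟩

theorem disjoint_inv_mul_of_cycleFactorsFinset_subset {σ τ : Perm α}
    (h : σ.cycleFactorsFinset ⊆ τ.cycleFactorsFinset) : Disjoint σ (σ⁻¹ * τ) := by
  obtain ⟨ρ, hρ⟩ := exists_cycleFactorsFinset_eq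
    (Finset.sdiff_subset (s := τ.cycleFactorsFinset) (t := σ.cycleFactorsFinset))
  have hd : Disjoint σ ρ := by
    rw [disjoint_iff_disjoint_support, Finset.disjoint_left]
    intro x hx hx'
    obtain ⟨c, hc, hxc⟩ := mem_support_iff_mem_support_of_mem_cycleFactorsFinset.1 hx
    obtain ⟨d, hd, hxd⟩ := mem_support_iff_mem_support_of_mem_cycleFactorsFinset.1 hx'
    rw [hρ, Finset.mem_sdiff] at hd
    have hcd : c ≠ d := fun e => hd.2 (e ▸ hc)
    exact (τ.cycleFactorsFinset_pairwise_disjoint (h hc) hd.1 hcd).mem_imp hxc hxd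
  have hm : σ * ρ = τ := cycleFactorsFinset_injective <| by
    rw [hd.cycleFactorsFinset_mul_eq_union, hρ, Finset.union_sdiff_of_subset h]
  rwa [← hm, inv_mul_cancel_left]

/-- The products of cycles of `τ`. -/
def subproducts (τ : Perm α) : Finset (Perm α) :=
  Finset.univ.filter fun σ => σ.cycleFactorsFinset ⊆ τ.cycleFactorsFinset

theorem mem_subproducts {σ τ : Perm α} : σ ∈ τ.subproducts ↔ Disjoint σ (σ⁻¹ * τ) := by
  simpa [subproducts] using
    ⟨disjoint_inv_mul_of_cycleFactorsFinset_subset, cycleFactorsFinset_subset_of_disjoint⟩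

theorem sum_powerset_cycleFactorsFinset {M : Type*} [AddCommMonoid M] (τ : Perm α)
    (F : Finset (Perm α) → M) :
    ∑ U ∈ τ.cycleFactorsFinset.powerset, F U =
      ∑ σ ∈ τ.subproducts, F σ.cycleFactorsFinset := by
  symm
  refine Finset.sum_bij (fun σ _ => σ.cycleFactorsFinset) ?_ ?_ ?_ fun _ _ => rfl
  · intro σ hσ
    exact Finset.mem_powerset.2 (cycleFactorsFinset_subset_of_disjoint (mem_subproducts.1 hσ))
  · intro σ _ σ' _ h
    exact cycleFactorsFinset_injective h
  · intro U hU
    rw [Finset.mem_powerset] at hU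
    obtain ⟨σ, rfl⟩ := exists_cycleFactorsFinset_eq hU
    exact ⟨σ, mem_subproducts.2 (disjoint_inv_mul_of_cycleFactorsFinset_subset hU), rfl⟩

theorem card_subproducts (τ : Perm α) :
    τ.subproducts.card = 2 ^ τ.cycleFactorsFinset.card := by
  rw [← Finset.card_powerset, Finset.card_eq_sum_ones, Finset.card_eq_sum_ones,
    sum_powerset_cycleFactorsFinset]

theorem prod_cycleFactorsFinset_prod_support {M : Type*} [CommMonoid M] (τ : Perm α)
    (f : α → M) :
    ∏ C ∈ τ.cycleFactorsFinset, ∏ i ∈ C.support, f i = ∏ i ∈ τ.support, f i := by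
  rw [← Finset.prod_biUnion]
  · congr 1
    ext x
    rw [Finset.mem_biUnion, mem_support_iff_mem_support_of_mem_cycleFactorsFinset]
  · exact fun c hc d hd hcd =>
      (τ.cycleFactorsFinset_pairwise_disjoint hc hd hcd).disjoint_support

theorem inv_mem_subproducts {σ τ : Perm α} (h : σ ∈ τ.subproducts) :
    σ⁻¹ ∈ (σ⁻¹ * τ * σ⁻¹).subproducts := by
  rw [mem_subproducts] at h ⊢
  rw [inv_mul_mul_inv_eq h, inv_inv, mul_inv_cancel_left]
  exact h.inv_left

theorem card_cycleFactorsFinset_inv_mul_mul_inv {σ τ : Perm α} (h : σ ∈ τ.subproducts) :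
    (σ⁻¹ * τ * σ⁻¹).cycleFactorsFinset.card = τ.cycleFactorsFinset.card := by
  rw [mem_subproducts] at h
  have key : (σ⁻¹ * τ * σ⁻¹).cycleType = τ.cycleType := by
    rw [inv_mul_mul_inv_eq h, h.inv_left.cycleType_mul, cycleType_inv, ← h.cycleType_mul,
      mul_inv_cancel_left]
  simpa [cycleType_def] using congrArg Multiset.card key

/-- The matchings `π₁ * σ⁻¹` and `π₂ * σ` arise from `π₁` and `π₂` by exchanging them along the
cycles of `σ`. -/
theorem prod_exchange {R : Type*} [CommMonoid R] (ν₁ ν₂ : α × α → R) {π₁ π₂ σ : Perm α}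
    (h : σ ∈ (π₂⁻¹ * π₁).subproducts) :
    ∏ i, ν₁ (i, (π₁ * σ⁻¹) i) * ν₂ (i, (π₂ * σ) i) =
      (∏ i ∈ (π₂⁻¹ * π₁).supportᶜ, ν₁ (i, π₁ i) * ν₂ (i, π₁ i)) *
        ((∏ i ∈ σ.support, ν₂ (i, π₁ i) * ν₁ (i, π₂ i)) *
          ∏ i ∈ (σ⁻¹ * (π₂⁻¹ * π₁)).support, ν₁ (i, π₁ i) * ν₂ (i, π₂ i)) := by
  rw [mem_subproducts] at h
  obtain ⟨ρ, hρ⟩ : ∃ ρ, ρ = σ⁻¹ * (π₂⁻¹ * π₁) := ⟨_, rfl⟩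
  rw [← hρ] at h ⊢
  have hπ : π₁ = π₂ * (σ * ρ) := by rw [hρ]; group
  have hτ : π₂⁻¹ * π₁ = σ * ρ := by rw [hπ]; group
  have h₁ : ∀ i, π₁ (σ⁻¹ i) = π₂ (ρ i) := fun i => by
    rw [hπ, h.commute.eq]; simp
  have h₂ : ∀ i, π₁ i = π₂ (σ (ρ i)) := fun i => by rw [hπ]; rfl
  rw [← Finset.prod_compl_mul_prod (π₂⁻¹ * π₁).support, hτ, h.support_mul,
    Finset.prod_union h.disjoint_support]
  simp only [mul_apply, h₁]
  congr 1
  · refine Finset.prod_congr rfl fun i hi => ?_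
    simp only [Finset.mem_compl, Finset.mem_union, not_or, notMem_support] at hi
    rw [h₂, hi.2, hi.1]
  · congr 1
    · refine Finset.prod_congr rfl fun i hi => ?_
      have hi' : ρ i = i := notMem_support.1 (h.mem_imp hi)
      rw [h₂, hi', mul_comm]
    · refine Finset.prod_congr rfl fun i hi => ?_
      have hi' : σ i = i := notMem_support.1 (h.symm.mem_imp hi)
      have hs : σ (ρ i) = ρ i := notMem_support.1 (h.symm.mem_imp (apply_mem_support.2 hi))
      rw [h₂, hs, hi']

theorem prod_loop_weights {R : Type*} [CommRing R] (ν₁ ν₂ : α × α → R) (π₁ π₂ : Perm α) :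
    (∏ i ∈ (π₂⁻¹ * π₁).supportᶜ, ν₁ (i, π₁ i) * ν₂ (i, π₁ i)) *
        ∏ C ∈ (π₂⁻¹ * π₁).cycleFactorsFinset,
          ((∏ i ∈ C.support, ν₁ (i, π₁ i)) * (∏ i ∈ C.support, ν₂ (i, π₂ i)) +
            (∏ i ∈ C.support, ν₂ (i, π₁ i)) * (∏ i ∈ C.support, ν₁ (i, π₂ i))) =
      ∑ σ ∈ (π₂⁻¹ * π₁).subproducts,
        ∏ i, ν₁ (i, (π₁ * σ⁻¹) i) * ν₂ (i, (π₂ * σ) i) := by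
  simp only [← Finset.prod_mul_distrib]
  simp_rw [add_comm (∏ i ∈ support _, ν₁ _ * ν₂ _)]
  rw [Finset.prod_add, sum_powerset_cycleFactorsFinset, Finset.mul_sum]
  refine Finset.sum_congr rfl fun σ hσ => ?_
  rw [prod_exchange ν₁ ν₂ hσ, ← cycleFactorsFinset_inv_mul (mem_subproducts.1 hσ),
    prod_cycleFactorsFinset_prod_support, prod_cycleFactorsFinset_prod_support]

theorem sum_exchange {M : Type*} [AddCommMonoid M] (F : ℕ → Perm α → Perm α → M) :
    ∑ π₁ : Perm α, ∑ π₂ : Perm α, ∑ σ ∈ (π₂⁻¹ * π₁).subproducts,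
        F (π₂⁻¹ * π₁).cycleFactorsFinset.card (π₁ * σ⁻¹) (π₂ * σ) =
      ∑ π₁ : Perm α, ∑ π₂ : Perm α, ∑ _σ ∈ (π₂⁻¹ * π₁).subproducts,
        F (π₂⁻¹ * π₁).cycleFactorsFinset.card π₁ π₂ := by
  have hτ (π₁ π₂ σ : Perm α) : (π₂ * σ)⁻¹ * (π₁ * σ⁻¹) = σ⁻¹ * (π₂⁻¹ * π₁) * σ⁻¹ := by group
  simp only [Finset.sum_sigma']
  refine Finset.sum_bij' (fun x _ => ⟨x.1 * x.2.2⁻¹, x.2.1 * x.2.2, x.2.2⁻¹⟩)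
    (fun x _ => ⟨x.1 * x.2.2⁻¹, x.2.1 * x.2.2, x.2.2⁻¹⟩) ?_ ?_ ?_ ?_ ?_
  · rintro ⟨π₁, π₂, σ⟩ h
    simp only [Finset.mem_sigma, Finset.mem_univ, true_and] at h ⊢
    rw [hτ]
    exact inv_mem_subproducts h
  · rintro ⟨π₁, π₂, σ⟩ h
    simp only [Finset.mem_sigma, Finset.mem_univ, true_and] at h ⊢
    rw [hτ]
    exact inv_mem_subproducts h
  · rintro ⟨π₁, π₂, σ⟩ _
    simp
  · rintro ⟨π₁, π₂, σ⟩ _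
    simp
  · rintro ⟨π₁, π₂, σ⟩ h
    simp only [Finset.mem_sigma, Finset.mem_univ, true_and] at h ⊢
    rw [hτ, card_cycleFactorsFinset_inv_mul_mul_inv h]

end Equiv.Perm

/-- The product of two dimer partition functions as a sum over double-dimer
configurations: pairs of matchings `(π₁, π₂)` are grouped according to
`τ = π₂⁻¹ ∘ π₁`, whose fixed points are doubled edges and whose nontrivial cycles
are the loops, each loop carrying the weight `w₁ + w₂` of its two alternating
decompositions. -/
theorem stmt2 {n : ℕ} (hn : 1 ≤ n) (ν₁ ν₂ : Fin n × Fin n → ℂ) :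
    (∑ π₁ : Equiv.Perm (Fin n), ∑ π₂ : Equiv.Perm (Fin n),
      ∏ i, ν₁ (i, π₁ i) * ν₂ (i, π₂ i)) =
    ∑ π₁ : Equiv.Perm (Fin n), ∑ π₂ : Equiv.Perm (Fin n),
      ((2 : ℂ) ^ ((π₂⁻¹ * π₁).cycleFactorsFinset.card))⁻¹ *
        (∏ i ∈ (π₂⁻¹ * π₁).supportᶜ, ν₁ (i, π₁ i) * ν₂ (i, π₁ i)) *
        ∏ C ∈ (π₂⁻¹ * π₁).cycleFactorsFinset,
          ((∏ i ∈ C.support, ν₁ (i, π₁ i)) * (∏ i ∈ C.support, ν₂ (i, π₂ i)) +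
            (∏ i ∈ C.support, ν₂ (i, π₁ i)) * (∏ i ∈ C.support, ν₁ (i, π₂ i))) := by
  simp_rw [mul_assoc (_ ⁻¹ : ℂ), Equiv.Perm.prod_loop_weights, Finset.mul_sum]
  rw [Equiv.Perm.sum_exchange fun k π₁ π₂ =>
    ((2 : ℂ) ^ k)⁻¹ * ∏ i, ν₁ (i, π₁ i) * ν₂ (i, π₂ i)]
  refine Finset.sum_congr rfl fun π₁ _ => Finset.sum_congr rfl fun π₂ _ => ?_
  rw [Finset.sum_const, Equiv.Perm.card_subproducts, nsmul_eq_mul, Nat.cast_pow, Nat.cast_ofNat,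
    mul_inv_cancel_left₀ (pow_ne_zero _ two_ne_zero)]
end

section
/- Let u : ℤ² → ℝ (values at vertices) and v : ℤ² → ℝ (values at faces, v(x,y) attached to the unit square [x,x+1]×[y,y+1]). Fix (x₀,y₀) ∈ ℤ² and c ∈ ℝ, and suppose the discrete Cauchy–Riemann equations u(x+1,y) − u(x,y) = v(x,y) − v(x,y−1) and u(x,y+1) − u(x,y) = v(x−1,y) − v(x,y) hold at every edge of ℤ² except the single horizontal edge from (x₀,y₀) to (x₀+1,y₀), where instead u(x₀+1,y₀) − u(x₀,y₀) − v(x₀,y₀) + v(x₀,y₀−1) = c. Then the discrete Laplacian Δh(p) = h(p+(1,0)) + h(p−(1,0)) + h(p+(0,1)) + h(p−(0,1)) − 4h(p) satisfies: Δu = c at (x₀,y₀), Δu = −c at (x₀+1,y₀), Δu = 0 at all other vertices; and Δv = c at the face (x₀,y₀), Δv = −c at the face (x₀,y₀−1), and Δv = 0 at all other faces. -/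
/-- If the Cauchy–Riemann equations hold at all vertical edges, the discrete Laplacian of `u` is the
horizontal backward difference of the defect of the equations at horizontal edges. -/
theorem laplacian_vertex_eq_defect_sub (u v : ℤ → ℤ → ℝ)
    (hCR : ∀ x y : ℤ, u x (y + 1) - u x y = v (x - 1) y - v x y) (x y : ℤ) :
    u (x + 1) y + u (x - 1) y + u x (y + 1) + u x (y - 1) - 4 * u x y =
      (u (x + 1) y - u x y - v x y + v x (y - 1)) -
        (u x y - u (x - 1) y - v (x - 1) y + v (x - 1) (y - 1)) := by
  have h₁ := hCR x y
  have h₂ := hCR x (y - 1)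
  rw [sub_add_cancel] at h₂
  linarith

/-- If the Cauchy–Riemann equations hold at all vertical edges, the discrete Laplacian of `v` is
minus the vertical forward difference of the defect of the equations at horizontal edges. -/
theorem laplacian_face_eq_defect_sub (u v : ℤ → ℤ → ℝ)
    (hCR : ∀ x y : ℤ, u x (y + 1) - u x y = v (x - 1) y - v x y) (x y : ℤ) :
    v (x + 1) y + v (x - 1) y + v x (y + 1) + v x (y - 1) - 4 * v x y =
      (u (x + 1) y - u x y - v x y + v x (y - 1)) -
        (u (x + 1) (y + 1) - u x (y + 1) - v x (y + 1) + v x y) := by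
  have h₁ := hCR x y
  have h₂ := hCR (x + 1) y
  rw [add_sub_cancel_right] at h₂
  linarith

/-- A discrete meromorphic function on ℤ² with a single pole of residue `c` at the
horizontal edge from `(x₀,y₀)` to `(x₀+1,y₀)`: the discrete Laplacians of the vertex
function `u` and of the face function `v` are point masses `±c` at the endpoints of the
edge, respectively at the two adjacent faces, and vanish elsewhere. -/
theorem stmt6 (u v : ℤ → ℤ → ℝ) (x₀ y₀ : ℤ) (c : ℝ)
    (hCR₁ : ∀ x y : ℤ, ¬(x = x₀ ∧ y = y₀) →
      u (x + 1) y - u x y = v x y - v x (y - 1))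
    (hCR₂ : ∀ x y : ℤ, u x (y + 1) - u x y = v (x - 1) y - v x y)
    (hpole : u (x₀ + 1) y₀ - u x₀ y₀ - v x₀ y₀ + v x₀ (y₀ - 1) = c) :
    let Δ : (ℤ → ℤ → ℝ) → ℤ → ℤ → ℝ := fun h x y =>
      h (x + 1) y + h (x - 1) y + h x (y + 1) + h x (y - 1) - 4 * h x y
    Δ u x₀ y₀ = c ∧ Δ u (x₀ + 1) y₀ = -c ∧
      (∀ x y : ℤ, ¬(x = x₀ ∧ y = y₀) → ¬(x = x₀ + 1 ∧ y = y₀) → Δ u x y = 0) ∧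
      Δ v x₀ y₀ = c ∧ Δ v x₀ (y₀ - 1) = -c ∧
      (∀ x y : ℤ, ¬(x = x₀ ∧ y = y₀) → ¬(x = x₀ ∧ y = y₀ - 1) → Δ v x y = 0) := by
  intro Δ
  have hu : ∀ x y, Δ u x y = _ := laplacian_vertex_eq_defect_sub u v hCR₂
  have hv : ∀ x y, Δ v x y = _ := laplacian_face_eq_defect_sub u v hCR₂
  refine ⟨?_, ?_, fun x y h h' => ?_, ?_, ?_, fun x y h h' => ?_⟩
  · have h₁ := hCR₁ (x₀ - 1) y₀ (by lia)
    rw [sub_add_cancel] at h₁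
    rw [hu]
    linarith
  · have h₁ := hCR₁ (x₀ + 1) y₀ (by lia)
    rw [hu, add_sub_cancel_right]
    linarith
  · have h₁ := hCR₁ x y h
    have h₂ := hCR₁ (x - 1) y (by lia)
    rw [sub_add_cancel] at h₂
    rw [hu]
    linarith
  · have h₁ := hCR₁ x₀ (y₀ + 1) (by lia)
    rw [add_sub_cancel_right] at h₁
    rw [hv]
    linarith
  · have h₁ := hCR₁ x₀ (y₀ - 1) (by lia)
    rw [hv, sub_add_cancel]
    linarith
  · have h₁ := hCR₁ x y h
    have h₂ := hCR₁ x (y + 1) (by lia)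
    rw [add_sub_cancel_right] at h₂
    rw [hv]
    linarith
end

section
/- Fix τ > 0 and x > 0, and set q = e^{−πτ}. For each even integer m ≥ 2 let n_m be a positive integer, and assume n_m/m → τ as m → ∞. For 1 ≤ k ≤ m set r_{k,m} = √(1 + cos²(πk/(m+1))) − |cos(πk/(m+1))|. Then lim_{m→∞, m even} ∏_{k=1}^{m} (1 + r_{k,m}^{2 n_m} · x)(1 + r_{k,m}^{2 n_m} · x^{−1}) = ∏_{j ≥ 1, j odd} (1 + q^j x)² (1 + q^j x^{−1})², where the infinite product on the right converges. -/
open Filter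

open scoped Topology

/-- The modulus of the smaller root of `X² + 2 i s X + 1 = 0`. -/
noncomputable def smallRoot (s : ℝ) : ℝ := √(1 + s ^ 2) - |s|

lemma smallRoot_neg (s : ℝ) : smallRoot (-s) = smallRoot s := by
  simp [smallRoot]

lemma smallRoot_nonneg (s : ℝ) : 0 ≤ smallRoot s :=
  sub_nonneg.2 (Real.abs_le_sqrt (by linarith))

lemma smallRoot_eq_exp {s : ℝ} (hs : 0 ≤ s) : smallRoot s = Real.exp (-Real.arsinh s) := by
  rw [← Real.arsinh_neg, Real.exp_arsinh, smallRoot, abs_of_nonneg hs, neg_sq]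
  ring

lemma smallRoot_le_exp {s : ℝ} (hs : 0 ≤ s) (hs1 : s ≤ 1) :
    smallRoot s ≤ Real.exp (-(s / 2)) := by
  have h1 : √(1 + s ^ 2) ≤ 1 + s / 2 := by
    rw [Real.sqrt_le_left (by positivity)]
    nlinarith
  have h2 := Real.add_one_le_exp (-(s / 2))
  rw [smallRoot, abs_of_nonneg hs]
  linarith

/-- The angles `πk/(m+1)`, `1 ≤ k ≤ m` with `m` even, are symmetric about `π/2`. -/
lemma prod_Icc_cos_eq_prod_range_sin (f : ℝ → ℝ) (hf : ∀ s, f (-s) = f s) (M : ℕ) :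
    ∏ k ∈ Finset.Icc 1 (2 * M), f (Real.cos (Real.pi * k / ((2 * M : ℕ) + 1))) =
      ∏ i ∈ Finset.range M,
        f (Real.sin (Real.pi * (2 * i + 1) / (2 * ((2 * M : ℕ) + 1)))) ^ 2 := by
  rw [← Finset.Ico_add_one_right_eq_Icc, Finset.prod_Ico_eq_prod_range, Nat.add_sub_cancel,
    two_mul, Finset.prod_range_add, ← Finset.prod_range_reflect, ← Finset.prod_mul_distrib]
  refine Finset.prod_congr rfl fun i hi => ?_
  have hi' : i + 1 ≤ M := Finset.mem_range.1 hi
  have hM : ((M : ℝ) + M + 1) ≠ 0 := by positivity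
  have h1 : Real.cos (Real.pi * (1 + (M - 1 - i) : ℕ) / ((M + M : ℕ) + 1)) =
      Real.sin (Real.pi * (2 * i + 1) / (2 * ((M + M : ℕ) + 1))) := by
    rw [← Real.cos_pi_div_two_sub]
    congr 1
    rw [show 1 + (M - 1 - i) = M - i by lia, Nat.cast_sub (by lia)]
    push_cast
    field_simp
    ring
  have h2 : Real.cos (Real.pi * (1 + (M + i) : ℕ) / ((M + M : ℕ) + 1)) =
      -Real.sin (Real.pi * (2 * i + 1) / (2 * ((M + M : ℕ) + 1))) := by
    rw [← Real.cos_add_pi_div_two]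
    congr 1
    push_cast
    field_simp
    ring
  rw [h1, h2, hf, sq]

lemma tendsto_arsinh_sin_div :
    Tendsto (fun y : ℝ => Real.arsinh (Real.sin y) / y) (𝓝[≠] 0) (𝓝 1) := by
  have h : HasDerivAt (fun y : ℝ => Real.arsinh (Real.sin y)) 1 0 := by
    simpa using (Real.hasDerivAt_sin 0).arsinh
  simpa [div_eq_inv_mul] using hasDerivAt_iff_tendsto_slope_zero.1 h

lemma tendsto_smallRoot_pow {l : Filter ℕ} (hl : l ≤ atTop) {N : ℕ → ℕ} {τ : ℝ}
    (hN : Tendsto (fun m : ℕ => (N m : ℝ) / m) l (𝓝 τ)) (i : ℕ) :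
    Tendsto (fun m : ℕ =>
        smallRoot (Real.sin (Real.pi * (2 * i + 1) / (2 * ((m : ℝ) + 1)))) ^ (2 * N m))
      l (𝓝 (Real.exp (-(Real.pi * τ)) ^ (2 * i + 1))) := by
  set y : ℕ → ℝ := fun m => Real.pi * (2 * i + 1) / (2 * ((m : ℝ) + 1)) with hy
  have hypos : ∀ m, 0 < y m := fun m => by positivity
  have hy0 : Tendsto y l (𝓝 0) := by
    refine Tendsto.mono_left ?_ hl
    have := (tendsto_one_div_add_atTop_nhds_zero_nat (𝕜 := ℝ)).const_mul
      (Real.pi * (2 * i + 1) / 2)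
    rw [mul_zero] at this
    refine this.congr fun m => ?_
    simp only [hy]
    field_simp
  have hratio : Tendsto (fun m => Real.arsinh (Real.sin (y m)) / y m) l (𝓝 1) :=
    tendsto_arsinh_sin_div.comp
      (tendsto_nhdsWithin_iff.2 ⟨hy0, Eventually.of_forall fun m => (hypos m).ne'⟩)
  have hm : Tendsto (fun m : ℕ => (m : ℝ) / (m + 1)) l (𝓝 1) :=
    (tendsto_natCast_div_add_atTop (1 : ℝ)).mono_left hl
  have hlim := Real.continuous_exp.continuousAt.tendsto.comp
    ((((hN.mul hm).mul_const (Real.pi * (2 * i + 1))).mul hratio).neg)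
  have hval : Real.exp (-(τ * 1 * (Real.pi * (2 * i + 1)) * 1)) =
      Real.exp (-(Real.pi * τ)) ^ (2 * i + 1) := by
    rw [← Real.exp_nat_mul]
    congr 1
    push_cast
    ring
  rw [← hval]
  refine hlim.congr' ?_
  filter_upwards [hl (eventually_ge_atTop (max 1 i))] with m hm
  have hm1 : 1 ≤ m := (le_max_left _ _).trans hm
  have hmi : (i : ℝ) ≤ m := mod_cast (le_max_right _ _).trans hm
  have hm0 : (m : ℝ) ≠ 0 := by positivity
  have hsin : 0 ≤ Real.sin (y m) := by
    refine Real.sin_nonneg_of_nonneg_of_le_pi (hypos m).le ?_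
    rw [hy, div_le_iff₀ (by positivity)]
    exact mul_le_mul_of_nonneg_left (by linarith) Real.pi_pos.le
  rw [smallRoot_eq_exp hsin, ← Real.exp_nat_mul, Function.comp_apply]
  congr 1
  have hy2 : Real.pi * (2 * i + 1) = y m * (2 * (m + 1)) := by
    simp only [hy]
    field_simp
  have := (hypos m).ne'
  rw [hy2]
  push_cast
  field_simp

lemma smallRoot_pow_le {m i n : ℕ} (hi : 2 * i + 1 ≤ m + 1) {c : ℝ} (hc : 0 ≤ c)
    (hn : c * (m + 1) ≤ n) :
    smallRoot (Real.sin (Real.pi * (2 * i + 1) / (2 * ((m : ℝ) + 1)))) ^ (2 * n) ≤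
      Real.exp (-c) ^ i := by
  have hi' : (2 * i + 1 : ℝ) ≤ m + 1 := mod_cast hi
  set s := Real.sin (Real.pi * (2 * i + 1) / (2 * ((m : ℝ) + 1))) with hs
  have hjs : (2 * i + 1 : ℝ) / (m + 1) ≤ s := by
    have h := Real.mul_le_sin (x := Real.pi * (2 * i + 1) / (2 * ((m : ℝ) + 1)))
      (by positivity) (by
        rw [div_le_div_iff₀ (by positivity) two_pos]
        nlinarith [Real.pi_pos])
    refine le_of_eq_of_le ?_ h
    field_simp
  have hs0 : 0 ≤ s := le_trans (by positivity) hjs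
  refine (pow_le_pow_left₀ (smallRoot_nonneg s)
    (smallRoot_le_exp hs0 (Real.sin_le_one _)) _).trans ?_
  rw [← Real.exp_nat_mul, ← Real.exp_nat_mul, Real.exp_le_exp]
  have h1 : c * (m + 1) * ((2 * i + 1) / (m + 1)) ≤ n * s := by gcongr
  have h2 : c * (m + 1) * ((2 * i + 1) / (m + 1)) = c * (2 * i + 1) := by field_simp
  have h3 : 0 ≤ c * (i + 1) := by positivity
  push_cast
  linarith

lemma abs_sq_mul_sub_one_le {x a : ℝ} (hx : 0 < x) (ha : 0 ≤ a) (ha1 : a ≤ 1) :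
    |((1 + a * x) * (1 + a * x⁻¹)) ^ 2 - 1| ≤ (x + x⁻¹ + 1) * (2 + (x + x⁻¹ + 1)) * a := by
  have hS : 0 < x + x⁻¹ + 1 := by positivity
  set S := x + x⁻¹ + 1 with hSdef
  obtain ⟨u, hu⟩ : ∃ u, u = a * x + a * x⁻¹ + a ^ 2 := ⟨_, rfl⟩
  have hu0 : 0 ≤ u := by rw [hu]; positivity
  have huS : u ≤ S * a := by
    rw [hu, hSdef]
    nlinarith
  have hprod : ((1 + a * x) * (1 + a * x⁻¹)) ^ 2 - 1 = u * (2 + u) := by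
    rw [hu]
    field_simp
    ring
  rw [hprod, abs_of_nonneg (by positivity)]
  calc u * (2 + u) ≤ S * a * (2 + S) := by
        gcongr
        exact huS.trans (mul_le_of_le_one_right hS.le ha1)
    _ = S * (2 + S) * a := by ring

/-- Scaling limit of the correction factor in the double-dimer partition function on
the cylinder: with `q = e^{-πτ}`, `x > 0`, `r_{k,m} = √(1 + cos²(πk/(m+1))) -
|cos(πk/(m+1))|`, and positive integers `n_m` with `n_m/m → τ` along even `m`,
the products `∏_{k=1}^m (1 + r_{k,m}^{2n_m} x)(1 + r_{k,m}^{2n_m} x⁻¹)` converge, as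
`m → ∞` through even values, to the convergent infinite product
`∏_{j ≥ 1 odd} (1 + q^j x)² (1 + q^j x⁻¹)²`. -/
theorem stmt12 (τ : ℝ) (hτ : 0 < τ) (x : ℝ) (hx : 0 < x)
    (N : ℕ → ℕ) (hNpos : ∀ m : ℕ, Even m → 2 ≤ m → 0 < N m)
    (hNτ : Tendsto (fun m : ℕ => (N m : ℝ) / m)
      (atTop ⊓ Filter.principal {m : ℕ | Even m}) (nhds τ)) :
    let q : ℝ := Real.exp (-(Real.pi * τ))
    let r : ℕ → ℕ → ℝ := fun k m =>
      Real.sqrt (1 + Real.cos (Real.pi * k / (m + 1)) ^ 2) -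
        |Real.cos (Real.pi * k / (m + 1))|
    let P : ℕ → ℝ := fun j =>
      if Odd j then (1 + q ^ j * x) ^ 2 * (1 + q ^ j * x⁻¹) ^ 2 else 1
    Multipliable P ∧
      Tendsto
        (fun m : ℕ => ∏ k ∈ Finset.Icc 1 m,
          (1 + r k m ^ (2 * N m) * x) * (1 + r k m ^ (2 * N m) * x⁻¹))
        (atTop ⊓ Filter.principal {m : ℕ | Even m}) (nhds (∏' j, P j)) := by
  intro q r P
  set l : Filter ℕ := atTop ⊓ Filter.principal {m : ℕ | Even m} with hl
  have hl_le : l ≤ atTop := inf_le_left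
  have hq0 : 0 < q := Real.exp_pos _
  have hq1 : q < 1 := Real.exp_lt_one_iff.2 (neg_lt_zero.2 (by positivity))
  let F : ℝ → ℝ := fun a => ((1 + a * x) * (1 + a * x⁻¹)) ^ 2 - 1
  let C : ℝ := (x + x⁻¹ + 1) * (2 + (x + x⁻¹ + 1))
  have hC : 0 ≤ C := by positivity
  have hFle : ∀ a, 0 ≤ a → a ≤ 1 → ‖F a‖ ≤ C * a := fun a => abs_sq_mul_sub_one_le hx
  have hFcont : Continuous F := by fun_prop
  have hPF : ∀ i, P (2 * i + 1) = 1 + F (q ^ (2 * i + 1)) := fun i => by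
    simp only [P, F, if_pos (odd_two_mul_add_one i)]
    ring
  have hsumF : Summable fun i : ℕ => ‖F (q ^ (2 * i + 1))‖ := by
    refine Summable.of_nonneg_of_le (fun _ => norm_nonneg _) (fun i => ?_)
      ((summable_geometric_of_lt_one hq0.le hq1).mul_left C)
    refine (hFle _ (by positivity) (pow_le_one₀ hq0.le hq1.le)).trans ?_
    exact mul_le_mul_of_nonneg_left (pow_le_pow_of_le_one hq0.le hq1.le (by lia)) hC
  have hP : HasProd P (∏' i : ℕ, (1 + F (q ^ (2 * i + 1)))) := by
    have hinj : Function.Injective fun i : ℕ => 2 * i + 1 := fun a b h => by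
      simpa using h
    refine (hinj.hasProd_iff fun j hj => ?_).1 ?_
    · refine if_neg fun ⟨i, hi⟩ => hj ⟨i, hi.symm⟩
    · rw [show (P ∘ fun i : ℕ => 2 * i + 1) = fun i => 1 + F (q ^ (2 * i + 1)) from funext hPF]
      exact (multipliable_one_add_of_summable hsumF).hasProd
  refine ⟨hP.multipliable, ?_⟩
  rw [hP.tprod_eq]
  let g : ℕ → ℕ → ℝ := fun m i => if i < m / 2 then
    smallRoot (Real.sin (Real.pi * (2 * i + 1) / (2 * ((m : ℝ) + 1)))) ^ (2 * N m) else 0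
  have hglim : ∀ i, Tendsto (fun m => g m i) l (𝓝 (q ^ (2 * i + 1))) := fun i => by
    refine (tendsto_smallRoot_pow hl_le hNτ i).congr' ?_
    filter_upwards [hl_le (eventually_ge_atTop (2 * (i + 1)))] with m hm
    exact (if_pos (by lia)).symm
  have hτ4 : Real.exp (-(τ / 4)) < 1 := Real.exp_lt_one_iff.2 (neg_lt_zero.2 (by positivity))
  have hmain : Tendsto (fun m => ∏' i, (1 + F (g m i))) l
      (𝓝 (∏' i : ℕ, (1 + F (q ^ (2 * i + 1))))) := by
    refine tendsto_tprod_one_add_of_dominated_convergence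
      ((summable_geometric_of_lt_one (Real.exp_pos _).le hτ4).mul_left C)
      (fun i => (hFcont.tendsto _).comp (hglim i)) ?_
    filter_upwards [hNτ.eventually (lt_mem_nhds (half_lt_self hτ)),
      hl_le (eventually_ge_atTop 1)] with m hm hm1 i
    have hg : 0 ≤ g m i ∧ g m i ≤ Real.exp (-(τ / 4)) ^ i := by
      simp only [g]
      split_ifs with h
      · refine ⟨pow_nonneg (smallRoot_nonneg _) _, ?_⟩
        refine smallRoot_pow_le (by lia) (by positivity) ?_
        have hm1' : (1 : ℝ) ≤ m := mod_cast hm1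
        rw [lt_div_iff₀ (by linarith)] at hm
        nlinarith
      · exact ⟨le_rfl, by positivity⟩
    refine (hFle _ hg.1 (hg.2.trans (pow_le_one₀ (Real.exp_pos _).le hτ4.le))).trans ?_
    exact mul_le_mul_of_nonneg_left hg.2 hC
  refine hmain.congr' ?_
  have hev : ∀ᶠ m in l, Even m := mem_inf_of_right (mem_principal_self _)
  filter_upwards [hev] with m hm
  obtain ⟨M, rfl⟩ := even_iff_exists_two_mul.1 hm
  have hsymm := prod_Icc_cos_eq_prod_range_sin
    (fun s => (1 + smallRoot s ^ (2 * N (2 * M)) * x) *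
      (1 + smallRoot s ^ (2 * N (2 * M)) * x⁻¹))
    (fun s => by simp only [smallRoot_neg]) M
  refine Eq.trans ?_ hsymm.symm
  rw [tprod_eq_prod (s := Finset.range M) fun i hi => ?_]
  · refine Finset.prod_congr rfl fun i hi => ?_
    have : i < 2 * M / 2 := by simpa using hi
    simp only [g, F, if_pos this]
    ring
  · have : ¬ i < 2 * M / 2 := by simpa using hi
    simp [g, F, if_neg this]
end
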